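/- There is a constant C > 0, independent of T and v, with the following property. Let v : [0,T]×ℝ³ → ℝ³ be smooth, Schwartz in the space variable for each t, with div v = 0. Then |∫₀^T (v·∇v | v)_{H²} dt| ≤ C ‖∇v‖²_{L²_T(H²)} ‖v‖_{L^∞_T(H²)}. -/

import Mathlib

open MeasureTheory Real Set Filter
open scoped ENNReal NNReal

noncomputable section

/-- Spatial points of `ℝ³`. -/
abbrev Pt : Type := Fin 3 → ℝ

/-- Partial derivative in the `i`-th coordinate direction. -/
def pd (i : Fin 3) (f : Pt → ℝ) : Pt → ℝ := fun x => fderiv ℝ f x (Pi.single i 1)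

/-- Iterated partial derivative `∂^α` for a multi-index `α`. -/
def pdM (α : Fin 3 → ℕ) (f : Pt → ℝ) : Pt → ℝ :=
  (pd 0)^[α 0] ((pd 1)^[α 1] ((pd 2)^[α 2] f))

/-- Multi-indices of total degree at most `k`. -/
def midx (k : ℕ) : Finset (Fin 3 → ℕ) :=
  (Fintype.piFinset fun _ => Finset.range (k + 1)).filter fun α => ∑ i, α i ≤ k

/-- The `H^k` inner product `(f|g)_{H^k} = ∑_{|α| ≤ k} ∫ ∂^α f ∂^α g`. -/
def hInner (k : ℕ) (f g : Pt → ℝ) : ℝ := ∑ α ∈ midx k, ∫ x : Pt, pdM α f x * pdM α g x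

/-- The squared `H^k` norm. -/
def hSq (k : ℕ) (f : Pt → ℝ) : ℝ := hInner k f f

/-- The squared `L²` norm. -/
def l2Sq (f : Pt → ℝ) : ℝ := ∫ x : Pt, (f x) ^ 2

/-- The Laplacian. -/
def lapl (f : Pt → ℝ) : Pt → ℝ := fun x => ∑ i, pd i (pd i f) x

/-- Horizontal directions. -/
def hIdx : Finset (Fin 3) := {0, 1}

/-- `L^∞` norm in time over `[0,T]` of a (nonnegative) function of time. -/
def supT (T : ℝ) (g : ℝ → ℝ) : ℝ := sSup (g '' Icc 0 T)

/-- `L²` norm in time over `[0,T]`. -/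
def l2T (T : ℝ) (g : ℝ → ℝ) : ℝ := Real.sqrt (∫ t in (0:ℝ)..T, (g t) ^ 2)

/-- `L⁴` norm in time over `[0,T]`. -/
def l4T (T : ℝ) (g : ℝ → ℝ) : ℝ := (∫ t in (0:ℝ)..T, (g t) ^ 4) ^ ((1:ℝ)/4)

/-- A function is Schwartz: smooth with all derivatives rapidly decaying. -/
def IsSchwartz (f : Pt → ℝ) : Prop :=
  ContDiff ℝ (⊤ : ℕ∞) f ∧ ∀ k n : ℕ, ∃ C : ℝ, ∀ x, ‖x‖ ^ k * ‖iteratedFDeriv ℝ n f x‖ ≤ C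

/-- Smoothness of `f` jointly in `(t,x)` on `s ×ˢ ℝ³`. -/
def SmoothOn2 (s : Set ℝ) (f : ℝ → Pt → ℝ) : Prop :=
  ContDiffOn ℝ (⊤ : ℕ∞) (fun q : ℝ × Pt => f q.1 q.2) (s ×ˢ (univ : Set Pt))

/-- `‖∇f‖_{H^k}²`. -/
def gradHSq (k : ℕ) (f : Pt → ℝ) : ℝ := ∑ i, hSq k (pd i f)

/-- `‖∇_h∇f‖_{H^k}²`. -/
def gradHHSq (k : ℕ) (f : Pt → ℝ) : ℝ := ∑ i ∈ hIdx, ∑ j, hSq k (pd i (pd j f))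

/-- `‖v‖_{H^k}²` for a vector field. -/
def vecHSq (k : ℕ) (v : Fin 3 → Pt → ℝ) : ℝ := ∑ j, hSq k (v j)

/-- `‖∇v‖_{H^k}²` for a vector field. -/
def gradVecHSq (k : ℕ) (v : Fin 3 → Pt → ℝ) : ℝ := ∑ j, gradHSq k (v j)

/-- `B_T²`. -/
def BTsq (T : ℝ) (ψ : ℝ → Pt → ℝ) (v : Fin 3 → ℝ → Pt → ℝ) : ℝ :=
  (supT T fun t => Real.sqrt (vecHSq 2 fun j => v j t)) ^ 2
  + (supT T fun t => Real.sqrt (gradHSq 2 (ψ t))) ^ 2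
  + (l2T T fun t => Real.sqrt (gradVecHSq 2 fun j => v j t)) ^ 2
  + (l2T T fun t => Real.sqrt (gradHHSq 1 (ψ t))) ^ 2

/-- `B_T`. -/
def BT (T : ℝ) (ψ : ℝ → Pt → ℝ) (v : Fin 3 → ℝ → Pt → ℝ) : ℝ := Real.sqrt (BTsq T ψ v)

/-- The transport equation `∂_tψ + v·∇ψ + v₃ = 0` on `s × ℝ³`. -/
def TransportEq (s : Set ℝ) (ψ : ℝ → Pt → ℝ) (v : Fin 3 → ℝ → Pt → ℝ) : Prop :=
  ∀ t ∈ s, ∀ x, deriv (fun τ => ψ τ x) t + (∑ i, v i t x * pd i (ψ t) x) + v 2 t x = 0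

/-- Divergence-free condition on `s × ℝ³`. -/
def DivFree (s : Set ℝ) (v : Fin 3 → ℝ → Pt → ℝ) : Prop :=
  ∀ t ∈ s, ∀ x, (∑ i, pd i (fun y => v i t y) x) = 0

/-- The momentum equations of system (S) on `s × ℝ³`. -/
def MomentumEq (s : Set ℝ) (ψ : ℝ → Pt → ℝ) (v : Fin 3 → ℝ → Pt → ℝ)
    (p : ℝ → Pt → ℝ) : Prop :=
  ∀ j : Fin 3, ∀ t ∈ s, ∀ x,
    deriv (fun τ => v j τ x) t + (∑ i, v i t x * pd i (v j t) x) - lapl (v j t) x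
      + pd j (p t) x + pd j (pd 2 (ψ t)) x + (if j = 2 then lapl (ψ t) x else 0)
    = - ∑ i, pd i (fun y => pd j (ψ t) y * pd i (ψ t) y) x

/-- The full system (S) on `s × ℝ³`. -/
def SolvesS (s : Set ℝ) (ψ : ℝ → Pt → ℝ) (v : Fin 3 → ℝ → Pt → ℝ)
    (p : ℝ → Pt → ℝ) : Prop :=
  TransportEq s ψ v ∧ MomentumEq s ψ v p ∧ DivFree s v

/-- Finiteness of the four norms entering `B_T`. -/
def FiniteClass (T : ℝ) (ψ : ℝ → Pt → ℝ) (v : Fin 3 → ℝ → Pt → ℝ) : Prop :=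
  BddAbove ((fun t => Real.sqrt (vecHSq 2 fun j => v j t)) '' Icc 0 T) ∧
  BddAbove ((fun t => Real.sqrt (gradHSq 2 (ψ t))) '' Icc 0 T) ∧
  IntervalIntegrable (fun t => gradVecHSq 2 fun j => v j t) volume 0 T ∧
  IntervalIntegrable (fun t => gradHHSq 1 (ψ t)) volume 0 T


open scoped SchwartzMap LineDeriv FourierTransform

/-- The Cauchy–Schwarz inequality for square-integrable functions. -/
lemma integral_norm_mul_norm_le_sqrt_mul_sqrt {α E : Type*} [MeasurableSpace α]
    [NormedAddCommGroup E] {μ : Measure α} {f g : α → E} (hf : MemLp f 2 μ) (hg : MemLp g 2 μ) :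
    ∫ x, ‖f x‖ * ‖g x‖ ∂μ ≤ √(∫ x, ‖f x‖ ^ 2 ∂μ) * √(∫ x, ‖g x‖ ^ 2 ∂μ) := by
  have h := integral_mul_norm_le_Lp_mul_Lq (μ := μ) (f := f) (g := g)
    Real.HolderConjugate.two_two (by simpa using hf) (by simpa using hg)
  simpa [Real.sqrt_eq_rpow] using h

/-- The function `f - ∑ᵢ ∂ᵢ∂ᵢ f`. -/
def oneSubLaplacian {V F ι : Type*} [NormedAddCommGroup V] [NormedSpace ℝ V]
    [NormedAddCommGroup F] [NormedSpace ℝ F] [Fintype ι] (b : ι → V) (f : 𝓢(V, F)) : 𝓢(V, F) :=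
  f - ∑ i, ∂_{b i} (∂_{b i} f)

lemma fourier_oneSubLaplacian {V ι : Type*} [NormedAddCommGroup V] [InnerProductSpace ℝ V]
    [FiniteDimensional ℝ V] [MeasurableSpace V] [BorelSpace V] [Fintype ι]
    (b : OrthonormalBasis ι ℝ V) (f : 𝓢(V, ℂ)) (ξ : V) :
    𝓕 (oneSubLaplacian b f) ξ = ((1 + (2 * π) ^ 2 * ‖ξ‖ ^ 2 : ℝ) : ℂ) * 𝓕 f ξ := by
  have hlin : 𝓕 (oneSubLaplacian b f) = 𝓕 f - ∑ i, 𝓕 (∂_{b i} (∂_{b i} f)) := by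
    simp only [oneSubLaplacian, ← SchwartzMap.fourierTransformCLM_apply ℂ, map_sub, map_sum]
  have hD : ∀ (g : 𝓢(V, ℂ)) (i : ι), 𝓕 (∂_{b i} g) ξ
      = (2 * π * Complex.I) * ((inner ℝ ξ (b i) : ℝ) * 𝓕 g ξ) := by
    intro g i
    have : (inner ℝ · (b i)).HasTemperateGrowth := ((innerSL ℝ).flip (b i)).hasTemperateGrowth
    rw [SchwartzMap.fourier_lineDerivOp_eq]
    simp [SchwartzMap.smulLeftCLM_apply_apply this]
  have hnorm : ‖ξ‖ ^ 2 = ∑ i, (inner ℝ ξ (b i)) ^ 2 := by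
    rw [← b.sum_sq_norm_inner_left ξ]
    simp
  rw [hlin, hnorm]
  have hs : (∑ i, 𝓕 (∂_{b i} (∂_{b i} f))) ξ = ∑ i, 𝓕 (∂_{b i} (∂_{b i} f)) ξ := by
    simp
  simp only [sub_apply, hs, hD]
  push_cast
  rw [add_mul, Finset.mul_sum, Finset.sum_mul, one_mul, sub_eq_add_neg, ← Finset.sum_neg_distrib]
  congr 1
  refine Finset.sum_congr rfl fun i _ => ?_
  linear_combination (-(2 * π) ^ 2 * (inner ℝ ξ (b i) : ℂ) ^ 2 * 𝓕 f ξ) * Complex.I_sq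

/-- The embedding `H² ⊂ L^∞` in dimension at most three. -/
lemma exists_norm_le_sqrt_oneSubLaplacian {V ι : Type*} [NormedAddCommGroup V]
    [InnerProductSpace ℝ V] [FiniteDimensional ℝ V] [MeasurableSpace V] [BorelSpace V]
    [Fintype ι] (b : OrthonormalBasis ι ℝ V) (hV : Module.finrank ℝ V ≤ 3) :
    ∃ K : ℝ, 0 ≤ K ∧ ∀ (f : 𝓢(V, ℂ)) (x : V),
      ‖f x‖ ≤ K * √(∫ y, ‖oneSubLaplacian b f y‖ ^ 2) := by
  set w : V → ℂ := fun ξ => (((1 + ‖ξ‖ ^ 2)⁻¹ : ℝ) : ℂ) with hw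
  have hwn : ∀ ξ, ‖w ξ‖ = (1 + ‖ξ‖ ^ 2)⁻¹ := fun ξ => by
    rw [hw, Complex.norm_real, Real.norm_of_nonneg (by positivity)]
  have hwc : Continuous w := by
    refine Complex.continuous_ofReal.comp (Continuous.inv₀ (by fun_prop) fun ξ => ?_)
    positivity
  have hw2 : MemLp w 2 := by
    rw [memLp_two_iff_integrable_sq_norm hwc.aestronglyMeasurable]
    have hlt : (Module.finrank ℝ V : ℝ) < 4 := by
      exact_mod_cast Nat.lt_succ_of_le hV
    refine (integrable_rpow_neg_one_add_norm_sq (μ := volume) hlt).congr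
      (Eventually.of_forall fun ξ => ?_)
    simp only [hwn]
    rw [show (-4 / 2 : ℝ) = -((2 : ℕ) : ℝ) by norm_num, Real.rpow_neg (by positivity),
      Real.rpow_natCast, inv_pow]
  refine ⟨√(∫ ξ, ‖w ξ‖ ^ 2), Real.sqrt_nonneg _, fun f x => ?_⟩
  have hfx : ‖f x‖ ≤ ∫ ξ, ‖𝓕 f ξ‖ := by
    have h1 : f x = 𝓕 (𝓕 f) (-x) := by
      conv_lhs => rw [← FourierTransform.fourierInv_fourier_eq (F := 𝓢(V, ℂ)) f, SchwartzMap.fourierInv_apply_eq]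
      simp
    rw [h1]
    simpa [SchwartzMap.norm_toLp_one] using SchwartzMap.norm_fourier_apply_le_toLp_one (𝓕 f) (-x)
  rw [← SchwartzMap.integral_norm_sq_fourier]
  refine hfx.trans (le_trans ?_ (integral_norm_mul_norm_le_sqrt_mul_sqrt hw2
    ((𝓕 (oneSubLaplacian b f)).memLp 2)))
  refine integral_mono ((𝓕 f).integrable.norm)
    (hw2.norm.integrable_mul ((𝓕 (oneSubLaplacian b f)).memLp 2).norm) fun ξ => ?_
  simp only [hwn, fourier_oneSubLaplacian, norm_mul, Complex.norm_real]
  rw [Real.norm_of_nonneg (by positivity), ← mul_assoc]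
  refine le_mul_of_one_le_left (norm_nonneg _) ?_
  rw [inv_mul_eq_div, one_le_div (by positivity)]
  have : 1 ≤ (2 * π) ^ 2 := by nlinarith [Real.pi_gt_three]
  nlinarith [sq_nonneg ‖ξ‖]


/-- The coordinate vectors of `ℝ³`. -/
def coordVec (i : Fin 3) : Pt := Pi.single i 1

lemma lineDerivOp_coordVec_coe (i : Fin 3) (f : 𝓢(Pt, ℝ)) :
    ⇑(∂_{coordVec i} f : 𝓢(Pt, ℝ)) = pd i f := rfl

lemma lineDerivOp_postcompCLM_ofReal {V : Type*} [NormedAddCommGroup V] [NormedSpace ℝ V]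
    (m : V) (f : 𝓢(V, ℝ)) :
    ∂_{m} (f.postcompCLM Complex.ofRealCLM) = (∂_{m} f).postcompCLM Complex.ofRealCLM := by
  ext x
  have h : ⇑(f.postcompCLM Complex.ofRealCLM) = Complex.ofRealCLM ∘ f := rfl
  rw [SchwartzMap.lineDerivOp_apply_eq_fderiv, h,
    fderiv_comp x Complex.ofRealCLM.differentiableAt f.differentiableAt]
  simp [SchwartzMap.lineDerivOp_apply_eq_fderiv]

lemma exists_abs_le_sqrt_oneSubLaplacian :
    ∃ K : ℝ, 0 ≤ K ∧ ∀ (f : 𝓢(Pt, ℝ)) (x : Pt),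
      |f x| ≤ K * √(∫ y, (oneSubLaplacian coordVec f y) ^ 2) := by
  let b := EuclideanSpace.basisFun (Fin 3) ℝ
  obtain ⟨K, hK, h⟩ := exists_norm_le_sqrt_oneSubLaplacian b (by simp)
  refine ⟨K, hK, fun f x => ?_⟩
  let L : EuclideanSpace ℝ (Fin 3) ≃L[ℝ] Pt := EuclideanSpace.equiv (Fin 3) ℝ
  let g : 𝓢(EuclideanSpace ℝ (Fin 3), ℂ) :=
    (SchwartzMap.compCLMOfContinuousLinearEquiv ℝ L f).postcompCLM Complex.ofRealCLM
  have hL : ∀ i, L (b i) = coordVec i := fun i => by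
    ext k
    simp [L, b, coordVec, Pi.single_apply]
  have hg : ∀ y, oneSubLaplacian b g y = (oneSubLaplacian coordVec f (L y) : ℝ) := fun y => by
    simp [oneSubLaplacian, g, lineDerivOp_postcompCLM_ofReal,
      SchwartzMap.lineDerivOp_compCLMOfContinuousLinearEquiv, hL]
  have hx := h g (L.symm x)
  have hgx : ‖g (L.symm x)‖ = |f x| := by simp [g]
  have hint : ∫ y, ‖oneSubLaplacian b g y‖ ^ 2 = ∫ y, (oneSubLaplacian coordVec f y) ^ 2 := by
    simp only [hg, Complex.norm_real, Real.norm_eq_abs, sq_abs]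
    exact (EuclideanSpace.volume_preserving_symm_measurableEquiv_toLp (Fin 3)).integral_comp'
      (fun y => (oneSubLaplacian coordVec f y) ^ 2)
  rwa [hgx, hint] at hx

lemma lineDerivOp_comm {V F : Type*} [NormedAddCommGroup V] [NormedSpace ℝ V]
    [NormedAddCommGroup F] [NormedSpace ℝ F] (m n : V) (f : 𝓢(V, F)) :
    ∂_{m} (∂_{n} f) = ∂_{n} (∂_{m} f) := by
  have key : ∀ (m n : V) (x : V), ∂_{m} (∂_{n} f) x = fderiv ℝ (fderiv ℝ f) x m n := by
    intro m n x
    have hd : DifferentiableAt ℝ (fderiv ℝ f) x :=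
      (SchwartzMap.fderivCLM ℝ V F f).differentiableAt
    have h : ⇑(∂_{n} f : 𝓢(V, F)) = fun y => fderiv ℝ f y n := rfl
    rw [SchwartzMap.lineDerivOp_apply_eq_fderiv, h, fderiv_clm_apply hd (by fun_prop)]
    simp
  ext x
  rw [key, key]
  exact ((f.contDiffAt 2 (x := x)).isSymmSndFDerivAt (by simp)) m n

lemma pdM_cases_of_mem_midx_two {α : Fin 3 → ℕ} (hα : α ∈ midx 2) :
    (∀ f, pdM α f = f) ∨ (∃ a, ∀ f, pdM α f = pd a f) ∨ ∃ a b, ∀ f, pdM α f = pd a (pd b f) := by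
  simp only [midx, Finset.mem_filter, Fin.sum_univ_three] at hα
  have hsum := hα.2
  have h0 : α 0 ≤ 2 := by omega
  have h1 : α 1 ≤ 2 := by omega
  have h2 : α 2 ≤ 2 := by omega
  simp only [pdM]
  generalize α 0 = p at *
  generalize α 1 = q at *
  generalize α 2 = r at *
  clear hα
  interval_cases p <;> interval_cases q <;> interval_cases r <;>
    first
    | omega
    | exact Or.inl fun f => rfl
    | exact Or.inr (Or.inl ⟨0, fun f => rfl⟩)
    | exact Or.inr (Or.inl ⟨1, fun f => rfl⟩)
    | exact Or.inr (Or.inl ⟨2, fun f => rfl⟩)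
    | exact Or.inr (Or.inr ⟨0, 0, fun f => rfl⟩)
    | exact Or.inr (Or.inr ⟨0, 1, fun f => rfl⟩)
    | exact Or.inr (Or.inr ⟨0, 2, fun f => rfl⟩)
    | exact Or.inr (Or.inr ⟨1, 1, fun f => rfl⟩)
    | exact Or.inr (Or.inr ⟨1, 2, fun f => rfl⟩)
    | exact Or.inr (Or.inr ⟨2, 2, fun f => rfl⟩)

lemma exists_mem_midx_two_pdM_eq_self : ∃ α ∈ midx 2, ∀ f, pdM α f = f :=
  ⟨0, by simp [midx], fun _ => rfl⟩

lemma exists_mem_midx_two_pdM_eq_pd (a : Fin 3) : ∃ α ∈ midx 2, ∀ f, pdM α f = pd a f := by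
  refine ⟨Pi.single a 1, ?_, fun f => ?_⟩
  · fin_cases a <;> decide
  · fin_cases a <;> rfl

lemma exists_mem_midx_two_pdM_eq_pd_pd (a b : Fin 3) :
    ∃ α ∈ midx 2, ∀ f : 𝓢(Pt, ℝ), pdM α f = pd a (pd b f) := by
  have hcomm : ∀ (a b : Fin 3) (f : 𝓢(Pt, ℝ)), pd a (pd b f) = pd b (pd a f) := fun a b f =>
    congrArg DFunLike.coe (lineDerivOp_comm (coordVec a) (coordVec b) f)
  refine ⟨Pi.single a 1 + Pi.single b 1, ?_, fun f => ?_⟩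
  · fin_cases a <;> fin_cases b <;> decide
  · fin_cases a <;> fin_cases b <;> first | rfl | exact hcomm _ _ f

/-- The `L²` norm of a Schwartz function. -/
def l2Norm (f : 𝓢(Pt, ℝ)) : ℝ := √(∫ x, f x ^ 2)

/-- The `H²` norm of a Schwartz function. -/
def h2Norm (f : 𝓢(Pt, ℝ)) : ℝ := √(hSq 2 f)

lemma integral_pdM_sq_le_hSq (f : Pt → ℝ) {k : ℕ} {α : Fin 3 → ℕ} (hα : α ∈ midx k) :
    ∫ x, pdM α f x ^ 2 ≤ hSq k f := by
  simp only [pow_two]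
  exact Finset.single_le_sum (f := fun α => ∫ x, pdM α f x * pdM α f x)
    (fun β _ => integral_nonneg fun x => mul_self_nonneg _) hα

lemma hSq_nonneg (k : ℕ) (f : Pt → ℝ) : 0 ≤ hSq k f :=
  Finset.sum_nonneg fun _ _ => integral_nonneg fun _ => mul_self_nonneg _

lemma l2Norm_le_h2Norm (f : 𝓢(Pt, ℝ)) : l2Norm f ≤ h2Norm f := by
  obtain ⟨α, hα, h⟩ := exists_mem_midx_two_pdM_eq_self
  have := integral_pdM_sq_le_hSq f hα
  rw [h] at this
  exact Real.sqrt_le_sqrt this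

lemma l2Norm_lineDerivOp_le_h2Norm (a : Fin 3) (f : 𝓢(Pt, ℝ)) :
    l2Norm (∂_{coordVec a} f) ≤ h2Norm f := by
  obtain ⟨α, hα, h⟩ := exists_mem_midx_two_pdM_eq_pd a
  have := integral_pdM_sq_le_hSq f hα
  rw [h] at this
  exact Real.sqrt_le_sqrt this

lemma l2Norm_lineDerivOp_lineDerivOp_le_h2Norm (a b : Fin 3) (f : 𝓢(Pt, ℝ)) :
    l2Norm (∂_{coordVec a} (∂_{coordVec b} f)) ≤ h2Norm f := by
  obtain ⟨α, hα, h⟩ := exists_mem_midx_two_pdM_eq_pd_pd a b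
  have := integral_pdM_sq_le_hSq f hα
  rw [h] at this
  exact Real.sqrt_le_sqrt this

lemma integral_sq_eq_l2Norm_sq (f : 𝓢(Pt, ℝ)) : ∫ x, f x ^ 2 = l2Norm f ^ 2 :=
  (Real.sq_sqrt (integral_nonneg fun _ => sq_nonneg _)).symm

/-- The Sobolev embedding `H²(ℝ³) ⊂ L^∞(ℝ³)` for Schwartz functions. -/
lemma exists_abs_le_h2Norm :
    ∃ K : ℝ, 0 ≤ K ∧ ∀ (f : 𝓢(Pt, ℝ)) (x : Pt), |f x| ≤ K * h2Norm f := by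
  obtain ⟨K, hK, h⟩ := exists_abs_le_sqrt_oneSubLaplacian
  refine ⟨K * 4, by positivity, fun f x => (h f x).trans ?_⟩
  rw [mul_assoc]
  refine mul_le_mul_of_nonneg_left ?_ hK
  have hn : 0 ≤ h2Norm f := Real.sqrt_nonneg _
  refine Real.sqrt_le_iff.2 ⟨by positivity, ?_⟩
  let d : Fin 3 → 𝓢(Pt, ℝ) := fun i => ∂_{coordVec i} (∂_{coordVec i} f)
  have hint : ∀ g : 𝓢(Pt, ℝ), Integrable fun y => g y ^ 2 := fun g => (g.memLp 2).integrable_sq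
  have h0 : Integrable fun y => f y ^ 2 + d 0 y ^ 2 := (hint f).add (hint (d 0))
  have h01 : Integrable fun y => f y ^ 2 + d 0 y ^ 2 + d 1 y ^ 2 := h0.add (hint (d 1))
  calc ∫ y, oneSubLaplacian coordVec f y ^ 2
      ≤ ∫ y, 4 * (f y ^ 2 + d 0 y ^ 2 + d 1 y ^ 2 + d 2 y ^ 2) := by
        refine integral_mono (hint _) ((h01.add (hint (d 2))).const_mul 4) fun y => ?_
        have : oneSubLaplacian coordVec f y = f y - (d 0 y + d 1 y + d 2 y) := by
          simp [oneSubLaplacian, d, Fin.sum_univ_three]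
        simp only [this]
        nlinarith [sq_nonneg (f y + d 0 y), sq_nonneg (f y + d 1 y), sq_nonneg (f y + d 2 y),
          sq_nonneg (d 0 y - d 1 y), sq_nonneg (d 0 y - d 2 y), sq_nonneg (d 1 y - d 2 y)]
    _ = 4 * (l2Norm f ^ 2 + l2Norm (d 0) ^ 2 + l2Norm (d 1) ^ 2 + l2Norm (d 2) ^ 2) := by
        rw [integral_const_mul, integral_add h01 (hint (d 2)), integral_add h0 (hint (d 1)),
          integral_add (hint f) (hint (d 0))]
        simp only [integral_sq_eq_l2Norm_sq]
    _ ≤ 4 * (h2Norm f ^ 2 + h2Norm f ^ 2 + h2Norm f ^ 2 + h2Norm f ^ 2) := by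
        have h0 : ∀ g, 0 ≤ l2Norm g := fun g => Real.sqrt_nonneg _
        have hd := fun i => l2Norm_lineDerivOp_lineDerivOp_le_h2Norm i i f
        gcongr
        exacts [h0 _, l2Norm_le_h2Norm f, h0 _, hd 0, h0 _, hd 1, h0 _, hd 2]
    _ = (4 * h2Norm f) ^ 2 := by ring

/-- The pointwise product of Schwartz functions. -/
def schwartzMul (f g : 𝓢(Pt, ℝ)) : 𝓢(Pt, ℝ) :=
  SchwartzMap.pairing (ContinuousLinearMap.mul ℝ ℝ) f g

@[simp] lemma schwartzMul_apply (f g : 𝓢(Pt, ℝ)) (x : Pt) : schwartzMul f g x = f x * g x := rfl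

lemma lineDerivOp_schwartzMul (m : Pt) (f g : 𝓢(Pt, ℝ)) :
    ∂_{m} (schwartzMul f g) = schwartzMul (∂_{m} f) g + schwartzMul f (∂_{m} g) := by
  ext x
  have h : ⇑(schwartzMul f g) = ⇑f * ⇑g := rfl
  rw [SchwartzMap.lineDerivOp_apply_eq_fderiv, h,
    fderiv_mul f.differentiableAt g.differentiableAt]
  simp [SchwartzMap.lineDerivOp_apply_eq_fderiv]
  ring

lemma integral_schwartz_add_mul (f g h : 𝓢(Pt, ℝ)) :
    ∫ x, (f + g) x * h x = (∫ x, f x * h x) + ∫ x, g x * h x := by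
  have := integral_add (schwartzMul f h).integrable (schwartzMul g h).integrable (μ := volume)
  simpa [add_mul] using this

lemma integral_schwartz_sum_mul {ι : Type*} (s : Finset ι) (f : ι → 𝓢(Pt, ℝ)) (h : 𝓢(Pt, ℝ)) :
    ∫ x, (∑ i ∈ s, f i) x * h x = ∑ i ∈ s, ∫ x, f i x * h x := by
  have := integral_finsetSum (μ := volume) s fun i _ => (schwartzMul (f i) h).integrable
  simpa [Finset.sum_mul] using this

lemma abs_integral_schwartzMul_mul_le {f g h : 𝓢(Pt, ℝ)} {M G H : ℝ} (hf : ∀ x, |f x| ≤ M)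
    (hg : l2Norm g ≤ G) (hh : l2Norm h ≤ H) :
    |∫ x, schwartzMul f g x * h x| ≤ M * (G * H) := by
  have hM : 0 ≤ M := (abs_nonneg _).trans (hf 0)
  have hG : 0 ≤ G := (Real.sqrt_nonneg _).trans hg
  have hgh : ∫ x, ‖g x‖ * ‖h x‖ ≤ l2Norm g * l2Norm h := by
    simpa [l2Norm] using integral_norm_mul_norm_le_sqrt_mul_sqrt (g.memLp 2) (h.memLp 2)
  calc |∫ x, schwartzMul f g x * h x|
      ≤ ∫ x, M * (‖g x‖ * ‖h x‖) := by
        rw [← Real.norm_eq_abs]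
        refine norm_integral_le_of_norm_le (((g.memLp 2).norm.integrable_mul
          (h.memLp 2).norm).const_mul M) (Eventually.of_forall fun x => ?_)
        rw [schwartzMul_apply, norm_mul, norm_mul, mul_assoc]
        exact mul_le_mul_of_nonneg_right (hf x) (by positivity)
    _ = M * ∫ x, ‖g x‖ * ‖h x‖ := integral_const_mul _ _
    _ ≤ M * (G * H) := by
        refine mul_le_mul_of_nonneg_left (hgh.trans ?_) hM
        exact mul_le_mul hg hh (Real.sqrt_nonneg _) hG

lemma abs_integral_schwartzMul_mul_le' {f g h : 𝓢(Pt, ℝ)} {M F H : ℝ} (hg : ∀ x, |g x| ≤ M)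
    (hf : l2Norm f ≤ F) (hh : l2Norm h ≤ H) :
    |∫ x, schwartzMul f g x * h x| ≤ M * (F * H) := by
  have : schwartzMul f g = schwartzMul g f := by
    ext x
    simp [mul_comm]
  rw [this]
  exact abs_integral_schwartzMul_mul_le hg hf hh

/-- The transport term `v·∇f` for Schwartz functions. -/
def advect (u : Fin 3 → 𝓢(Pt, ℝ)) (f : 𝓢(Pt, ℝ)) : 𝓢(Pt, ℝ) :=
  ∑ i, schwartzMul (u i) (∂_{coordVec i} f)

lemma advect_coe (u : Fin 3 → 𝓢(Pt, ℝ)) (f : 𝓢(Pt, ℝ)) :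
    ⇑(advect u f) = fun x => ∑ i, u i x * pd i f x := by
  ext x
  simp [advect, ← lineDerivOp_coordVec_coe]

/-- The energy cancellation `∫ (v·∇f) f = 0` for a divergence-free field `v`. -/
lemma integral_advect_mul_self_eq_zero (u : Fin 3 → 𝓢(Pt, ℝ))
    (hdiv : ∑ i, ∂_{coordVec i} (u i) = 0) (f : 𝓢(Pt, ℝ)) :
    ∫ x, advect u f x * f x = 0 := by
  have h1 : ∀ i, 2 * ∫ x, schwartzMul (u i) (∂_{coordVec i} f) x * f x
      = -∫ x, (∂_{coordVec i} (u i)) x * schwartzMul f f x := by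
    intro i
    rw [← SchwartzMap.integral_mul_lineDerivOp_right_eq_neg_left, ← integral_const_mul]
    refine integral_congr_ae (Eventually.of_forall fun x => ?_)
    simp only [lineDerivOp_schwartzMul, add_apply, schwartzMul_apply]
    ring
  have h2 : ∑ i, ∫ x, (∂_{coordVec i} (u i)) x * schwartzMul f f x = 0 := by
    rw [← integral_schwartz_sum_mul, hdiv]
    simp
  have h3 : 2 * ∫ x, advect u f x * f x = 0 := by
    rw [advect, integral_schwartz_sum_mul, Finset.mul_sum, Finset.sum_congr rfl fun i _ => h1 i,
      Finset.sum_neg_distrib, h2, neg_zero]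
  linarith

section Trilinear

variable {K A B : ℝ} {u : Fin 3 → 𝓢(Pt, ℝ)}

lemma abs_integral_lineDerivOp_advect_le
    (hK : ∀ (f : 𝓢(Pt, ℝ)) (x : Pt), |f x| ≤ K * h2Norm f) (hK0 : 0 ≤ K)
    (hB : ∀ j, h2Norm (u j) ≤ B) (hA : ∀ i j, h2Norm (∂_{coordVec i} (u j)) ≤ A)
    (a j : Fin 3) :
    |∫ x, (∂_{coordVec a} (advect u (u j))) x * (∂_{coordVec a} (u j)) x|
      ≤ 12 * (K * A ^ 2 * B) := by
  have hA0 : 0 ≤ A := (Real.sqrt_nonneg _).trans (hA 0 0)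
  have hB0 : 0 ≤ B := (Real.sqrt_nonneg _).trans (hB 0)
  have hsB : ∀ i x, |u i x| ≤ K * B := fun i x =>
    (hK _ x).trans (mul_le_mul_of_nonneg_left (hB i) hK0)
  have hsA : ∀ i k x, |∂_{coordVec i} (u k) x| ≤ K * A := fun i k x =>
    (hK _ x).trans (mul_le_mul_of_nonneg_left (hA i k) hK0)
  have hexp : ∂_{coordVec a} (advect u (u j)) = ∑ i,
      (schwartzMul (∂_{coordVec a} (u i)) (∂_{coordVec i} (u j))
        + schwartzMul (u i) (∂_{coordVec a} (∂_{coordVec i} (u j)))) := by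
    rw [advect, LineDeriv.lineDerivOp_sum]
    simp only [lineDerivOp_schwartzMul]
  have hterm : ∀ i, |∫ x, (schwartzMul (∂_{coordVec a} (u i)) (∂_{coordVec i} (u j))
        + schwartzMul (u i) (∂_{coordVec a} (∂_{coordVec i} (u j)))) x * (∂_{coordVec a} (u j)) x|
      ≤ 4 * (K * A ^ 2 * B) := by
    intro i
    rw [integral_schwartz_add_mul]
    have e1 := abs_integral_schwartzMul_mul_le (hsA a i)
      ((l2Norm_le_h2Norm _).trans (hA i j))
      ((l2Norm_lineDerivOp_le_h2Norm a _).trans (hB j))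
    have e2 := abs_integral_schwartzMul_mul_le (hsB i)
      ((l2Norm_lineDerivOp_le_h2Norm a _).trans (hA i j))
      ((l2Norm_le_h2Norm _).trans (hA a j))
    have : 0 ≤ K * A ^ 2 * B := by positivity
    refine (abs_add_le _ _).trans ?_
    linarith
  rw [hexp, integral_schwartz_sum_mul]
  refine (Finset.abs_sum_le_sum_abs _ _).trans ((Finset.sum_le_sum fun i _ => hterm i).trans ?_)
  simp
  linarith

lemma abs_integral_lineDerivOp_lineDerivOp_advect_le
    (hK : ∀ (f : 𝓢(Pt, ℝ)) (x : Pt), |f x| ≤ K * h2Norm f) (hK0 : 0 ≤ K)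
    (hB : ∀ j, h2Norm (u j) ≤ B) (hA : ∀ i j, h2Norm (∂_{coordVec i} (u j)) ≤ A)
    (a b j : Fin 3) :
    |∫ x, (∂_{coordVec a} (∂_{coordVec b} (advect u (u j)))) x *
      (∂_{coordVec a} (∂_{coordVec b} (u j))) x| ≤ 12 * (K * A ^ 2 * B) := by
  have hA0 : 0 ≤ A := (Real.sqrt_nonneg _).trans (hA 0 0)
  have hB0 : 0 ≤ B := (Real.sqrt_nonneg _).trans (hB 0)
  have hsB : ∀ i x, |u i x| ≤ K * B := fun i x =>
    (hK _ x).trans (mul_le_mul_of_nonneg_left (hB i) hK0)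
  have hsA : ∀ i k x, |∂_{coordVec i} (u k) x| ≤ K * A := fun i k x =>
    (hK _ x).trans (mul_le_mul_of_nonneg_left (hA i k) hK0)
  have h2B : ∀ k, l2Norm (∂_{coordVec a} (∂_{coordVec b} (u k))) ≤ B := fun k =>
    (l2Norm_lineDerivOp_lineDerivOp_le_h2Norm a b _).trans (hB k)
  have h2A : ∀ c d k, l2Norm (∂_{coordVec c} (∂_{coordVec d} (u k))) ≤ A := fun c d k =>
    (l2Norm_lineDerivOp_le_h2Norm c _).trans (hA d k)
  have hexp : ∂_{coordVec a} (∂_{coordVec b} (advect u (u j))) = ∑ i,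
      ((schwartzMul (∂_{coordVec a} (∂_{coordVec b} (u i))) (∂_{coordVec i} (u j))
        + schwartzMul (∂_{coordVec b} (u i)) (∂_{coordVec a} (∂_{coordVec i} (u j))))
        + (schwartzMul (∂_{coordVec a} (u i)) (∂_{coordVec b} (∂_{coordVec i} (u j)))
        + schwartzMul (u i) (∂_{coordVec a} (∂_{coordVec b} (∂_{coordVec i} (u j)))))) := by
    rw [advect, LineDeriv.lineDerivOp_sum, LineDeriv.lineDerivOp_sum]
    simp only [lineDerivOp_schwartzMul, LineDeriv.lineDerivOp_add]
  rw [hexp, integral_schwartz_sum_mul]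
  refine (Finset.abs_sum_le_sum_abs _ _).trans
    ((Finset.sum_le_sum (g := fun _ => 4 * (K * A ^ 2 * B)) fun i _ => ?_).trans ?_)
  · simp only [integral_schwartz_add_mul]
    have e1 := abs_integral_schwartzMul_mul_le' (hsA i j) (h2B i) (h2A a b j)
    have e2 := abs_integral_schwartzMul_mul_le (hsA b i) (h2A a i j) (h2B j)
    have e3 := abs_integral_schwartzMul_mul_le (hsA a i) (h2A b i j) (h2B j)
    have e4 := abs_integral_schwartzMul_mul_le (hsB i)
      ((l2Norm_lineDerivOp_lineDerivOp_le_h2Norm a b _).trans (hA i j)) (h2A a b j)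
    refine (abs_add_le _ _).trans ((add_le_add (abs_add_le _ _) (abs_add_le _ _)).trans ?_)
    linarith
  · simp
    linarith

end Trilinear

lemma exists_abs_sum_hInner_advect_le :
    ∃ C : ℝ, 0 < C ∧ ∀ u : Fin 3 → 𝓢(Pt, ℝ), ∑ i, ∂_{coordVec i} (u i) = 0 →
      |∑ j, hInner 2 (advect u (u j)) (u j)|
        ≤ C * gradVecHSq 2 (fun j => u j) * √(vecHSq 2 fun j => u j) := by
  obtain ⟨K, hK0, hK⟩ := exists_abs_le_h2Norm
  refine ⟨(midx 2).card * (36 * K) + 1, by positivity, fun u hdiv => ?_⟩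
  set B := √(vecHSq 2 fun j => u j) with hBdef
  set A := √(gradVecHSq 2 fun j => u j) with hAdef
  have hB0 : 0 ≤ B := Real.sqrt_nonneg _
  have hA2 : A ^ 2 = gradVecHSq 2 fun j => u j := Real.sq_sqrt
    (Finset.sum_nonneg fun _ _ => Finset.sum_nonneg fun _ _ => hSq_nonneg _ _)
  have hB : ∀ j, h2Norm (u j) ≤ B := fun j => Real.sqrt_le_sqrt
    (Finset.single_le_sum (f := fun j => hSq 2 (u j)) (fun _ _ => hSq_nonneg _ _)
      (Finset.mem_univ j))
  have hA : ∀ i j, h2Norm (∂_{coordVec i} (u j)) ≤ A := fun i j => Real.sqrt_le_sqrt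
    ((Finset.single_le_sum (f := fun i => hSq 2 (pd i (u j))) (fun _ _ => hSq_nonneg _ _)
      (Finset.mem_univ i)).trans (Finset.single_le_sum (f := fun j => gradHSq 2 (u j))
        (fun _ _ => Finset.sum_nonneg fun _ _ => hSq_nonneg _ _) (Finset.mem_univ j)))
  have hX : 0 ≤ K * A ^ 2 * B := by positivity
  have hsum : ∀ {F : Fin 3 → ℝ}, (∀ j, |F j| ≤ 12 * (K * A ^ 2 * B)) →
      |∑ j, F j| ≤ 36 * (K * A ^ 2 * B) := fun {F} hF => by
    refine (Finset.abs_sum_le_sum_abs _ _).trans ((Finset.sum_le_sum fun j _ => hF j).trans ?_)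
    simp
    linarith
  have hα : ∀ α ∈ midx 2, |∑ j, ∫ x, pdM α (advect u (u j)) x * pdM α (u j) x|
      ≤ 36 * (K * A ^ 2 * B) := by
    intro α hα
    rcases pdM_cases_of_mem_midx_two hα with h | ⟨a, h⟩ | ⟨a, b, h⟩
    · simp only [h, integral_advect_mul_self_eq_zero u hdiv]
      simpa using hX
    · simp only [h]
      exact hsum fun j => abs_integral_lineDerivOp_advect_le hK hK0 hB hA a j
    · simp only [h]
      exact hsum fun j => abs_integral_lineDerivOp_lineDerivOp_advect_le hK hK0 hB hA a b j
  simp only [hInner]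
  rw [Finset.sum_comm]
  refine (Finset.abs_sum_le_sum_abs _ _).trans ((Finset.sum_le_sum hα).trans ?_)
  rw [Finset.sum_const, nsmul_eq_mul, ← hA2]
  have : 0 ≤ A ^ 2 * B := by positivity
  nlinarith

/-- The estimate `I₁`: `|∫₀^T (v·∇v|v)_{H²} dt| ≤ C ‖∇v‖²_{L²_T(H²)} ‖v‖_{L^∞_T(H²)}`. -/
theorem stmt_15 :
    ∃ C : ℝ, 0 < C ∧ ∀ T : ℝ, 0 < T → ∀ v : Fin 3 → ℝ → Pt → ℝ,
      (∀ j, SmoothOn2 (Icc 0 T) (v j)) →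
      (∀ t ∈ Icc (0:ℝ) T, ∀ j, IsSchwartz (v j t)) →
      DivFree (Icc 0 T) v →
      BddAbove ((fun t => Real.sqrt (vecHSq 2 fun j => v j t)) '' Icc 0 T) →
      IntervalIntegrable (fun t => gradVecHSq 2 fun j => v j t) volume 0 T →
      |∫ t in (0:ℝ)..T, ∑ j, hInner 2 (fun x => ∑ i, v i t x * pd i (v j t) x) (v j t)| ≤
        C * (l2T T fun t => Real.sqrt (gradVecHSq 2 fun j => v j t)) ^ 2
          * (supT T fun t => Real.sqrt (vecHSq 2 fun j => v j t)) := by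
  obtain ⟨C, hC, h⟩ := exists_abs_sum_hInner_advect_le
  refine ⟨C, hC, fun T hT v _ hS hdiv hbdd hint => ?_⟩
  set S := supT T fun t => √(vecHSq 2 fun j => v j t) with hSdef
  have hpt : ∀ t ∈ Icc (0 : ℝ) T,
      |∑ j, hInner 2 (fun x => ∑ i, v i t x * pd i (v j t) x) (v j t)|
        ≤ C * S * gradVecHSq 2 fun j => v j t := by
    intro t ht
    let u : Fin 3 → 𝓢(Pt, ℝ) := fun j => ⟨v j t, (hS t ht j).1, (hS t ht j).2⟩
    have hu := h u (by
      ext x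
      simp only [sum_apply, zero_apply]
      exact hdiv t ht x)
    simp only [advect_coe] at hu
    refine hu.trans ?_
    have hle : √(vecHSq 2 fun j => v j t) ≤ S := le_csSup hbdd ⟨t, ht, rfl⟩
    have hg : 0 ≤ gradVecHSq 2 fun j => v j t :=
      Finset.sum_nonneg fun _ _ => Finset.sum_nonneg fun _ _ => hSq_nonneg _ _
    calc C * gradVecHSq 2 (fun j => v j t) * √(vecHSq 2 fun j => v j t)
        ≤ C * gradVecHSq 2 (fun j => v j t) * S :=
          mul_le_mul_of_nonneg_left hle (by positivity)
      _ = C * S * gradVecHSq 2 fun j => v j t := by ring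
  have hl2 : (l2T T fun t => √(gradVecHSq 2 fun j => v j t)) ^ 2
      = ∫ t in (0 : ℝ)..T, gradVecHSq 2 fun j => v j t := by
    have hg : ∀ t, 0 ≤ gradVecHSq 2 fun j => v j t := fun t =>
      Finset.sum_nonneg fun _ _ => Finset.sum_nonneg fun _ _ => hSq_nonneg _ _
    simp only [l2T, Real.sq_sqrt (hg _)]
    exact Real.sq_sqrt (intervalIntegral.integral_nonneg hT.le fun t _ => hg t)
  rw [hl2, ← Real.norm_eq_abs]
  refine (intervalIntegral.norm_integral_le_of_norm_le hT.le
    (Eventually.of_forall fun t ht => hpt t (Ioc_subset_Icc_self ht))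
    (hint.const_mul (C * S))).trans_eq ?_
  rw [intervalIntegral.integral_const_mul]
  ring

end
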